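/- Let m be odd and l coprime to m, and let f: GF(2^m) → GF(2^m) be f(α) = α^{2^l + 1}. Then f is a bijective APN operator and the system a+b+c+d = 0, a+b+e+t = 0, f(a)+f(b)+f(c)+f(d)+f(e)+f(t) = 0 has no solution with pairwise distinct a,b,c,d,e,t ∈ GF(2^m). -/

import Mathlib

theorem fix_of_coprime {F : Type*} [Field F] [Fintype F] [CharP F 2] {m k : ℕ}
    (hF : Fintype.card F = 2 ^ m) (hk : Nat.Coprime k m) (x : F) (hx : x ^ (2 ^ k) = x) :
    x = 0 ∨ x = 1 := by
  have h1 : Function.IsPeriodicPt (frobenius F 2) k x := by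
    unfold Function.IsPeriodicPt Function.IsFixedPt
    rw [iterate_frobenius]; exact hx
  have h2 : Function.IsPeriodicPt (frobenius F 2) m x := by
    unfold Function.IsPeriodicPt Function.IsFixedPt
    rw [iterate_frobenius, ← hF]; exact FiniteField.pow_card x
  have h3 := h1.gcd h2
  rw [hk] at h3
  have h4 : x ^ 2 = x := by
    simpa [Function.IsPeriodicPt, Function.IsFixedPt, frobenius_def] using h3
  have h5 : x * (x - 1) = 0 := by linear_combination h4
  rcases mul_eq_zero.mp h5 with h | h
  · exact Or.inl h
  · exact Or.inr (sub_eq_zero.mp h)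

/-- let `F = GF(2^m)` with `m` odd and `l` coprime to `m`, and let
`f α = α^(2^l + 1)`.  Then `f` is a bijective APN operator (for every `(a,b) ≠ (0,0)` the
system `x + y = a`, `f x + f y = b` has 0 or 2 solutions, i.e. `f x + f (x+a) = b` has 0
or 2 solutions `x`), and the system `a+b+c+d = 0`, `a+b+e+t = 0`,
`f a + f b + f c + f d + f e + f t = 0` has no solution in pairwise distinct elements. -/
theorem stmt19 {m l : ℕ} (hm : Odd m) (hlm : Nat.Coprime l m)
    (F : Type*) [Field F] [Fintype F] (hF : Fintype.card F = 2 ^ m) :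
    Function.Bijective (fun x : F => x ^ (2 ^ l + 1)) ∧
    (∀ a b : F, ¬(a = 0 ∧ b = 0) →
      Set.ncard {x : F | x ^ (2 ^ l + 1) + (x + a) ^ (2 ^ l + 1) = b} = 0 ∨
      Set.ncard {x : F | x ^ (2 ^ l + 1) + (x + a) ^ (2 ^ l + 1) = b} = 2) ∧
    ¬ ∃ a b c d e t : F,
        [a, b, c, d, e, t].Pairwise (· ≠ ·) ∧
        a + b + c + d = 0 ∧ a + b + e + t = 0 ∧
        a ^ (2 ^ l + 1) + b ^ (2 ^ l + 1) + c ^ (2 ^ l + 1) + d ^ (2 ^ l + 1) +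
          e ^ (2 ^ l + 1) + t ^ (2 ^ l + 1) = 0 := by
  have hm0 : m ≠ 0 := by rintro rfl; simp at hm
  have hchar : CharP F 2 := charP_of_card_eq_prime_pow (f := m) hF
  have h2 : (2 : F) = 0 := CharTwo.two_eq_zero
  have hl2 : Nat.Coprime (l + l) m := by
    rw [← two_mul]
    exact Nat.Coprime.mul_left (Nat.coprime_two_left.mpr hm) hlm
  have hadd : ∀ x y : F, (x + y) ^ (2 ^ l) = x ^ (2 ^ l) + y ^ (2 ^ l) :=
    fun x y => add_pow_char_pow x y 2 l
  have hfix : ∀ x : F, x ^ (2 ^ l) = x → x = 0 ∨ x = 1 := fix_of_coprime hF hlm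
  have hfix2 : ∀ x : F, (x ^ (2 ^ l)) ^ (2 ^ l) = x → x = 0 ∨ x = 1 := by
    intro x hx
    refine fix_of_coprime hF hl2 x ?_
    rw [pow_add, pow_mul]; exact hx
  have hpos : (2 ^ l : ℕ) ≠ 0 := by positivity
  refine ⟨?_, ?_, ?_⟩
  · apply Finite.injective_iff_bijective.mp
    intro x y hxy
    simp only at hxy
    by_cases hy : y = 0
    · subst hy
      simpa using hxy
    · have hz : (x / y) ^ (2 ^ l + 1) = 1 := by
        rw [div_pow, hxy, div_self (pow_ne_zero _ hy)]
      set z := x / y with hzd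
      have hz0 : z ≠ 0 := by
        intro h; rw [h] at hz; simp at hz
      have hz1 : z ^ (2 ^ l) = z⁻¹ := by
        rw [pow_succ] at hz
        exact eq_inv_of_mul_eq_one_left hz
      have hz2 : (z ^ (2 ^ l)) ^ (2 ^ l) = z := by
        rw [hz1, inv_pow, hz1, inv_inv]
      have hz3 := (hfix2 z hz2).resolve_left hz0
      rw [hzd, div_eq_one_iff_eq hy] at hz3
      exact hz3
  · intro a b hab
    by_cases ha : a = 0
    · subst ha
      left
      have hb : b ≠ 0 := fun h => hab ⟨rfl, h⟩
      have : {x : F | x ^ (2 ^ l + 1) + (x + 0) ^ (2 ^ l + 1) = b} = ∅ := by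
        ext x
        simp only [Set.mem_ofPred_eq, Set.mem_empty_iff_false, iff_false, add_zero]
        rw [CharTwo.add_self_eq_zero]
        exact fun h => hb h.symm
      rw [this, Set.ncard_empty]
    · rcases Set.eq_empty_or_nonempty
        {x : F | x ^ (2 ^ l + 1) + (x + a) ^ (2 ^ l + 1) = b} with h | ⟨x, hx⟩
      · left; rw [h, Set.ncard_empty]
      · right
        have : {x : F | x ^ (2 ^ l + 1) + (x + a) ^ (2 ^ l + 1) = b} = {x, x + a} := by
          ext y
          simp only [Set.mem_ofPred_eq, Set.mem_insert_iff, Set.mem_singleton_iff] at hx ⊢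
          constructor
          · intro hy
            obtain ⟨u, hu⟩ : ∃ u, y = x + u * a :=
              ⟨(y - x) / a, by field_simp; ring⟩
            simp only [pow_succ _ (2 ^ l), hu, hadd, mul_pow] at hx hy
            have hA : a ^ (2 ^ l) ≠ 0 := pow_ne_zero _ ha
            have h3 : a * a ^ (2 ^ l) * (u ^ (2 ^ l) - u) = 0 := by
              generalize a ^ (2 ^ l) = A at *
              generalize x ^ (2 ^ l) = X at *
              generalize u ^ (2 ^ l) = U at *
              linear_combination hy - hx -
                (X * u * a + U * A * x + U * A * u * a + u * a * A) * h2
            have h4 := (mul_eq_zero.mp h3).resolve_left (mul_ne_zero ha hA)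
            rcases hfix u (sub_eq_zero.mp h4) with h | h
            · left; rw [hu, h]; ring
            · right; rw [hu, h]; ring
          · rintro (rfl | rfl)
            · exact hx
            · rw [add_assoc, CharTwo.add_self_eq_zero, add_zero, add_comm]; exact hx
        rw [this, Set.ncard_pair]
        intro h
        exact ha (by simpa using h)
  · rintro ⟨a, b, c, d, e, t, hp, h1, h3, h4⟩
    have hab : a ≠ b := by
      simp only [List.pairwise_cons] at hp
      exact hp.1 b (by simp)
    obtain ⟨s, hs⟩ : ∃ s, s = a + b := ⟨_, rfl⟩
    have hs0 : s ≠ 0 := by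
      rw [hs]; intro h; exact hab (CharTwo.add_eq_zero.mp h)
    have hb : b = a + s := by linear_combination -hs - a * h2
    have hd : d = c + s := by linear_combination h1 - hs - c * h2 - (a + b) * h2
    have ht : t = e + s := by linear_combination h3 - hs - e * h2 - (a + b) * h2
    obtain ⟨u, hu⟩ : ∃ u, a = u * s + c + e :=
      ⟨(a - c - e) / s, by field_simp; ring⟩
    have hS : s ^ (2 ^ l) ≠ 0 := pow_ne_zero _ hs0
    simp only [pow_succ _ (2 ^ l), hb, hd, ht, hadd] at h4
    have hua : a ^ (2 ^ l) = u ^ (2 ^ l) * s ^ (2 ^ l) + c ^ (2 ^ l) + e ^ (2 ^ l) := by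
      rw [hu, hadd, hadd, mul_pow]
    rw [hua] at h4
    have h5 : s * s ^ (2 ^ l) * (u ^ (2 ^ l) + u + 1) = 0 := by
      generalize s ^ (2 ^ l) = S at *
      generalize c ^ (2 ^ l) = C at *
      generalize e ^ (2 ^ l) = E at *
      generalize u ^ (2 ^ l) = U at *
      subst hu
      grind
    have h6 := (mul_eq_zero.mp h5).resolve_left (mul_ne_zero hs0 hS)
    have h7 : u ^ (2 ^ l) = u + 1 := by linear_combination h6 - (u + 1) * h2
    have h8 : (u ^ (2 ^ l)) ^ (2 ^ l) = u := by
      rw [h7, hadd, h7, one_pow]; linear_combination h2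
    rcases hfix2 u h8 with h | h
    · rw [h, zero_pow hpos] at h7; simp at h7
    · rw [h, one_pow] at h7; simp at h7
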